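/- arXiv:2006.13923 — 2 statements merged into one kernel-verified Lean document; each statement's English description precedes it below -/
import Mathlib

section
/- Let r ≥ 2 be an integer, 0 < α ≤ (r-1)²/r², and let g ∈ ℝ[z_1,…,z_n] be a multi-affine real stable polynomial, g(z) = Σ_{A ⊆ [n]} a_A z^{A^c}, such that all roots of the diagonalization ḡ lie in [0,1], a_∅ = 1, and |a_{{i}}| ≤ α for every i ∈ [n]. Set p = g^r. Then for every real b > 1 and every i ∈ [n], the barrier function satisfies Φ_p^i(b·𝟏) ≤ r (α/(b−1) + (1−α)/b), where 𝟏 = (1,…,1). -/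
open MvPolynomial Polynomial

/-- A polynomial with real coefficients is *real stable* if it does not vanish
when all variables have positive imaginary part. -/
def RealStable {n : ℕ} (p : MvPolynomial (Fin n) ℝ) : Prop :=
  ∀ z : Fin n → ℂ, (∀ i, 0 < (z i).im) →
    MvPolynomial.eval z (MvPolynomial.map (algebraMap ℝ ℂ) p) ≠ 0

/-- A polynomial is *multi-affine* if it has degree at most 1 in each variable. -/
def MultiAffine {n : ℕ} (p : MvPolynomial (Fin n) ℝ) : Prop :=
  ∀ i, p.degreeOf i ≤ 1

/-- The diagonalization `p̄(x) = p(x,…,x)` of a multivariate polynomial. -/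
noncomputable def diagPoly {n : ℕ} (p : MvPolynomial (Fin n) ℝ) : Polynomial ℝ :=
  MvPolynomial.aeval (fun _ => Polynomial.X) p

/-- The exponent of the multi-affine monomial `∏_{i ∈ A} z_i`. -/
noncomputable def expOf {n : ℕ} (A : Finset (Fin n)) : Fin n →₀ ℕ :=
  ∑ i ∈ A, Finsupp.single i 1

/-- `∂^S p = (∏_{i ∈ S} ∂/∂z_i) p`. -/
noncomputable def pderivs {n : ℕ} (S : Finset (Fin n)) (p : MvPolynomial (Fin n) ℝ) :
    MvPolynomial (Fin n) ℝ :=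
  S.toList.foldr (fun i q => MvPolynomial.pderiv i q) p

/-- The barrier function `Φ_p^i(u) = (∂_i p)(u) / p(u)`. -/
noncomputable def barrier {n : ℕ} (i : Fin n) (p : MvPolynomial (Fin n) ℝ)
    (u : Fin n → ℝ) : ℝ :=
  MvPolynomial.eval u (MvPolynomial.pderiv i p) / MvPolynomial.eval u p

/-- A polynomial fraction `f / h` that maps the upper half plane into the lower one, in the
quantitative form `Im (h / f) ≥ Im z`, with `h` split over `ℝ`, has only simple poles
with nonnegative residues. -/
theorem exists_partialFractions (N : ℕ) : ∀ f h : Polynomial ℝ, h.natDegree = N → h.Monic →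
    h.Splits → f.degree < h.degree →
    (∀ z : ℂ, 0 < z.im → z.im * Complex.normSq (Polynomial.aeval z f) ≤
      (Polynomial.aeval z h * (starRingEnd ℂ) (Polynomial.aeval z f)).im) →
    ∃ (s : Finset ℝ) (c : ℝ → ℝ) (q : ℝ → Polynomial ℝ),
      (∀ l ∈ s, h.IsRoot l ∧ 0 ≤ c l ∧ h = (Polynomial.X - Polynomial.C l) * q l) ∧
      f = ∑ l ∈ s, Polynomial.C (c l) * q l := by
  induction N with
  | zero =>
    intro f h hN hm hs hd hp
    refine ⟨∅, 0, 0, by simp, ?_⟩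
    have : h = 1 := Polynomial.eq_one_of_monic_natDegree_zero hm hN
    subst this
    rw [Finset.sum_empty, ← Polynomial.degree_eq_bot]
    simpa using hd
  | succ N ih =>
    intro f h hN hm hs hd hp
    by_cases hc : ∃ l, h.IsRoot l ∧ f.IsRoot l
    · obtain ⟨l, hl, hfl⟩ := hc
      obtain ⟨h', rfl⟩ := Polynomial.dvd_iff_isRoot.2 hl
      obtain ⟨f', rfl⟩ := Polynomial.dvd_iff_isRoot.2 hfl
      have hm' : h'.Monic := (Polynomial.monic_X_sub_C l).of_mul_monic_left hm
      have hX := Polynomial.X_sub_C_ne_zero l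
      have hN' : h'.natDegree = N := by
        rw [Polynomial.natDegree_mul hX hm'.ne_zero, Polynomial.natDegree_X_sub_C] at hN
        omega
      obtain ⟨s, c, q, hq, hf⟩ := ih f' h' hN' hm'
        (hs.of_dvd hm.ne_zero (dvd_mul_left _ _)) (by
          rw [Polynomial.degree_mul, Polynomial.degree_mul, Polynomial.degree_X_sub_C] at hd
          exact lt_of_add_lt_add_left hd) (by
          intro z hz
          have h1 := hp z hz
          have hne : z - (l : ℂ) ≠ 0 := by
            intro h0
            have := congrArg Complex.im h0
            simp at this
            exact hz.ne' this
          have hpos := Complex.normSq_pos.2 hne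
          have e : ∀ a u v : ℂ, (a * u * (starRingEnd ℂ) (a * v)).im =
              Complex.normSq a * (u * (starRingEnd ℂ) v).im := by
            intro a u v
            simp [Complex.normSq_apply]
            ring
          have e' : ∀ p : Polynomial ℝ, Polynomial.aeval z ((Polynomial.X - Polynomial.C l) * p) =
              (z - l) * Polynomial.aeval z p := by
            intro p
            simp
          rw [e', e', e, Complex.normSq_mul] at h1
          refine le_of_mul_le_mul_left ?_ hpos
          linarith)
      refine ⟨s, c, fun m => (Polynomial.X - Polynomial.C l) * q m, ?_, ?_⟩
      · intro m hm
        obtain ⟨h1, h2, h3⟩ := hq m hm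
        refine ⟨?_, h2, ?_⟩
        · simp [Polynomial.IsRoot.def.1 h1]
        · conv_lhs => rw [h3]
          ring
      · rw [hf, Finset.mul_sum]
        exact Finset.sum_congr rfl fun _ _ => by ring
    · push Not at hc
      have key : ∀ l, h.IsRoot l →
          (f.eval l) ^ 2 ≤ (h /ₘ (Polynomial.X - Polynomial.C l)).eval l * f.eval l := by
        intro l hl
        set q := h /ₘ (Polynomial.X - Polynomial.C l) with hq
        have hh : (Polynomial.X - Polynomial.C l) * q = h :=
          Polynomial.mul_divByMonic_eq_iff_isRoot.2 hl
        let w : ℝ → ℂ := fun t => (l : ℂ) + t * Complex.I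
        have hw : Continuous w := by fun_prop
        have ht : ∀ t ∈ Set.Ioi (0 : ℝ), Complex.normSq (Polynomial.aeval (w t) f) ≤
            (Polynomial.aeval (w t) q * (starRingEnd ℂ) (Polynomial.aeval (w t) f)).re := by
          intro t ht
          have ht : 0 < t := ht
          have h1 := hp (w t) (by simpa [w] using ht)
          rw [← hh] at h1
          simp only [map_mul, map_sub, Polynomial.aeval_X, Polynomial.aeval_C,
            Complex.coe_algebraMap] at h1
          have e1 : w t - (l : ℂ) = t * Complex.I := by simp [w]
          have e2 : (w t).im = t := by simp [w]
          have e3 : ∀ u : ℂ, (t * Complex.I * u).im = t * u.re := by intro u; simp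
          rw [e1, e2, mul_assoc, e3] at h1
          exact le_of_mul_le_mul_left h1 ht
        have h0 := le_on_closure (s := Set.Ioi (0 : ℝ)) ht
          (by apply Continuous.continuousOn; fun_prop)
          (by apply Continuous.continuousOn; fun_prop) (x := 0) (by simp)
        have ew : ∀ p : Polynomial ℝ, Polynomial.aeval (w 0) p = ((p.eval l : ℝ) : ℂ) := by
          intro p
          have : w 0 = algebraMap ℝ ℂ l := by simp [w]
          rw [this, Polynomial.aeval_algebraMap_apply]
          simp
        rw [ew, ew] at h0
        simp only [Complex.normSq_ofReal, Complex.conj_ofReal, ← Complex.ofReal_mul,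
          Complex.ofReal_re] at h0
        linarith
      have hqpos : ∀ l, h.IsRoot l →
          0 < (h /ₘ (Polynomial.X - Polynomial.C l)).eval l * f.eval l := by
        intro l hl
        have := hc l hl
        have h2 : 0 < (f.eval l) ^ 2 := by
          have : f.eval l ≠ 0 := this
          positivity
        exact h2.trans_le (key l hl)
      have hnd : h.roots.Nodup := by
        rw [Multiset.nodup_iff_count_le_one]
        intro l
        rw [Polynomial.count_roots]
        by_contra! hlt
        obtain ⟨h1, h2⟩ := (Polynomial.one_lt_rootMultiplicity_iff_isRoot hm.ne_zero).1 hlt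
        have h3 := hqpos l h1
        rw [← Polynomial.mul_divByMonic_eq_iff_isRoot.2 h1] at h2
        simp only [Polynomial.derivative_mul, Polynomial.IsRoot.def, Polynomial.eval_add,
          Polynomial.eval_mul, Polynomial.eval_sub, Polynomial.eval_X, Polynomial.eval_C,
          Polynomial.derivative_sub, Polynomial.derivative_X, Polynomial.derivative_C] at h2
        simp at h2
        simp [h2] at h3
      refine ⟨h.roots.toFinset,
        fun l => f.eval l / (h /ₘ (Polynomial.X - Polynomial.C l)).eval l,
        fun l => h /ₘ (Polynomial.X - Polynomial.C l), ?_, ?_⟩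
      · intro l hl
        have hl : h.IsRoot l := by simpa [hm.ne_zero] using hl
        refine ⟨hl, ?_, (Polynomial.mul_divByMonic_eq_iff_isRoot.2 hl).symm⟩
        have := hqpos l hl
        rw [div_nonneg_iff]
        rcases mul_pos_iff.1 this with h | h
        · exact Or.inl ⟨h.2.le, h.1.le⟩
        · exact Or.inr ⟨h.2.le, h.1.le⟩
      · have hcard : h.degree = h.roots.toFinset.card := by
          rw [Multiset.toFinset_card_of_nodup hnd, hs.degree_eq_card_roots hm.ne_zero]
        apply Polynomial.eq_of_degrees_lt_of_eval_finset_eq h.roots.toFinset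
        · rwa [← hcard]
        · refine (Polynomial.degree_sum_le _ _).trans_lt ?_
          rw [Finset.sup_lt_iff (by rw [← hcard, hcard]; exact WithBot.bot_lt_coe _)]
          intro l hl
          refine ((Polynomial.degree_mul_le _ _).trans
            (add_le_of_nonpos_left Polynomial.degree_C_le)).trans_lt ?_
          rw [← hcard]
          have hlt : (0 : WithBot ℕ) < (Polynomial.X - Polynomial.C l).degree := by
            rw [Polynomial.degree_X_sub_C]
            exact zero_lt_one
          exact Polynomial.degree_divByMonic_lt _ _ hm.ne_zero hlt
        · intro m hmr
          have hm' : h.IsRoot m := by simpa [hm.ne_zero] using hmr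
          rw [Polynomial.eval_finsetSum, Finset.sum_eq_single_of_mem m hmr]
          · have := hqpos m hm'
            rw [Polynomial.eval_mul, Polynomial.eval_C,
              div_mul_cancel₀ _ (left_ne_zero_of_mul this.ne')]
          · intro l hl hne
            have hl : h.IsRoot l := by simpa [hm.ne_zero] using hl
            have h1 : h.eval m = 0 := hm'
            rw [← Polynomial.mul_divByMonic_eq_iff_isRoot.2 hl] at h1
            simp only [Polynomial.eval_mul, Polynomial.eval_sub, Polynomial.eval_X,
              Polynomial.eval_C, mul_eq_zero, sub_eq_zero, hne.symm, false_or] at h1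
            simp [h1]

theorem expOf_apply {n : ℕ} (A : Finset (Fin n)) (i : Fin n) :
    expOf A i = if i ∈ A then 1 else 0 := by
  simp [expOf, Finsupp.finsetSum_apply, Finsupp.single_apply]

theorem sum_expOf {n : ℕ} (A : Finset (Fin n)) : ∑ i, expOf A i = A.card := by
  simp [expOf_apply]

theorem diagPoly_eq_sum {n : ℕ} (q : MvPolynomial (Fin n) ℝ) :
    diagPoly q = ∑ s ∈ q.support,
      Polynomial.C (MvPolynomial.coeff s q) * Polynomial.X ^ (∑ i, s i) := by
  simp [diagPoly, MvPolynomial.aeval_def, MvPolynomial.eval₂_eq', Finset.prod_pow_eq_pow_sum]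

theorem natDegree_diagPoly_le {n : ℕ} {q : MvPolynomial (Fin n) ℝ} {A : Finset (Fin n)}
    (hq : ∀ s ∈ q.support, s ≤ expOf A) : (diagPoly q).natDegree ≤ A.card := by
  rw [diagPoly_eq_sum]
  refine Polynomial.natDegree_sum_le_of_forall_le _ _ fun s hs => ?_
  refine (Polynomial.natDegree_C_mul_X_pow_le _ _).trans ?_
  rw [← sum_expOf]
  exact Finset.sum_le_sum fun i _ => hq s hs i

theorem coeff_diagPoly_card {n : ℕ} {q : MvPolynomial (Fin n) ℝ} {A : Finset (Fin n)}
    (hq : ∀ s ∈ q.support, s ≤ expOf A) :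
    (diagPoly q).coeff A.card = MvPolynomial.coeff (expOf A) q := by
  rw [diagPoly_eq_sum, Polynomial.finsetSum_coeff]
  simp only [Polynomial.coeff_C_mul_X_pow]
  rw [Finset.sum_eq_single (expOf A)]
  · simp [sum_expOf]
  · intro s hs hne
    rw [if_neg]
    intro h
    rw [← sum_expOf] at h
    refine hne (Finsupp.ext fun i => ?_)
    exact (Finset.sum_eq_sum_iff_of_le fun i _ => hq s hs i).1 h.symm i (Finset.mem_univ i)
  · intro h
    rw [MvPolynomial.notMem_support_iff.1 h, ite_self]

theorem MultiAffine.le_one {n : ℕ} {g : MvPolynomial (Fin n) ℝ} (hg : MultiAffine g)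
    {s : Fin n →₀ ℕ} (hs : MvPolynomial.coeff s g ≠ 0) (i : Fin n) : s i ≤ 1 :=
  MvPolynomial.degreeOf_le_iff.1 (hg i) s (MvPolynomial.mem_support_iff.2 hs)

/-- Subtracting `X_i ∂_i g` from a multi-affine polynomial `g` removes the monomials
containing `X_i`. -/
theorem MultiAffine.coeff_sub_X_mul_pderiv {n : ℕ} {g : MvPolynomial (Fin n) ℝ}
    (hg : MultiAffine g) (i : Fin n) (s : Fin n →₀ ℕ) :
    MvPolynomial.coeff s (g - MvPolynomial.X i * MvPolynomial.pderiv i g) =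
      if s i = 0 then MvPolynomial.coeff s g else 0 := by
  rw [MvPolynomial.coeff_sub, MvPolynomial.coeff_X_mul', MvPolynomial.coeff_pderiv]
  split_ifs with h1 h2 h2
  · simp_all
  · have hle : Finsupp.single i 1 ≤ s := by
      rw [Finsupp.single_le_iff]
      omega
    rw [tsub_add_cancel_of_le hle]
    by_cases h0 : MvPolynomial.coeff s g = 0
    · simp [h0]
    · have := hg.le_one h0 i
      have h3 : s i = 1 := by omega
      simp [h3]
  · simp
  · simp_all

theorem MultiAffine.coeff_pderiv_eq_zero {n : ℕ} {g : MvPolynomial (Fin n) ℝ}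
    (hg : MultiAffine g) (i : Fin n) {s : Fin n →₀ ℕ} (hs : s i ≠ 0) :
    MvPolynomial.coeff s (MvPolynomial.pderiv i g) = 0 := by
  rw [MvPolynomial.coeff_pderiv]
  by_cases h0 : MvPolynomial.coeff (s + Finsupp.single i 1) g = 0
  · simp [h0]
  · have := hg.le_one h0 i
    simp at this
    omega

theorem aeval_update_of_coeff_eq_zero {n : ℕ} {q : MvPolynomial (Fin n) ℝ} {i : Fin n}
    (hq : ∀ s : Fin n →₀ ℕ, s i ≠ 0 → MvPolynomial.coeff s q = 0) (z : Fin n → ℂ) (w : ℂ) :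
    MvPolynomial.aeval (Function.update z i w) q = MvPolynomial.aeval z q := by
  refine MvPolynomial.eval₂Hom_congr' rfl (fun j hj _ => ?_) rfl
  rw [Function.update_of_ne]
  rintro rfl
  obtain ⟨s, hs, hjs⟩ := (MvPolynomial.mem_vars_iff_mem_support j).1 hj
  exact MvPolynomial.mem_support_iff.1 hs (hq s (Finsupp.mem_support_iff.1 hjs))

theorem MultiAffine.aeval_update {n : ℕ} {g : MvPolynomial (Fin n) ℝ} (hg : MultiAffine g)
    (i : Fin n) (z : Fin n → ℂ) (w : ℂ) :
    MvPolynomial.aeval (Function.update z i (z i + w)) g =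
      MvPolynomial.aeval z g + w * MvPolynomial.aeval z (MvPolynomial.pderiv i g) := by
  have h0 := aeval_update_of_coeff_eq_zero (q := g - MvPolynomial.X i * MvPolynomial.pderiv i g)
    (i := i) (fun s hs => by rw [hg.coeff_sub_X_mul_pderiv, if_neg hs]) z (z i + w)
  have h1 := aeval_update_of_coeff_eq_zero (q := MvPolynomial.pderiv i g)
    (i := i) (fun s hs => hg.coeff_pderiv_eq_zero i hs) z (z i + w)
  simp only [map_sub, map_mul, MvPolynomial.aeval_X, h1, Function.update_self] at h0
  linear_combination h0

theorem aeval_diagPoly {n : ℕ} {K : Type*} [CommRing K] [Algebra ℝ K]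
    (q : MvPolynomial (Fin n) ℝ) (z : K) :
    Polynomial.aeval z (diagPoly q) = MvPolynomial.aeval (fun _ => z) q := by
  simp only [diagPoly]
  rw [← AlgHom.comp_apply]
  congr 1
  ext
  simp

theorem RealStable.aeval_ne_zero {n : ℕ} {g : MvPolynomial (Fin n) ℝ} (hg : RealStable g)
    {z : Fin n → ℂ} (hz : ∀ i, 0 < (z i).im) : MvPolynomial.aeval z g ≠ 0 := by
  rw [MvPolynomial.aeval_def, MvPolynomial.eval₂_eq_eval_map]
  exact hg z hz

theorem RealStable.im_mul_normSq_le {n : ℕ} {g : MvPolynomial (Fin n) ℝ} (hg : RealStable g)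
    (hma : MultiAffine g) (i : Fin n) {z : Fin n → ℂ} (hz : ∀ j, 0 < (z j).im) :
    (z i).im * Complex.normSq (MvPolynomial.aeval z (MvPolynomial.pderiv i g)) ≤
      (MvPolynomial.aeval z g *
        (starRingEnd ℂ) (MvPolynomial.aeval z (MvPolynomial.pderiv i g))).im := by
  set h := MvPolynomial.aeval z g with hh
  set f := MvPolynomial.aeval z (MvPolynomial.pderiv i g) with hf
  rcases eq_or_ne f 0 with h0 | h0
  · simp [h0]
  by_contra! hlt
  have hpos := Complex.normSq_pos.2 h0
  have him : (h / f).im = (h * (starRingEnd ℂ) f).im / Complex.normSq f := by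
    simp [Complex.div_im]
    ring
  have h1 : (h / f).im < (z i).im := by
    rwa [him, div_lt_iff₀ hpos]
  refine hg.aeval_ne_zero (z := Function.update z i (z i + -(h / f))) (fun j => ?_) ?_
  · rcases eq_or_ne j i with rfl | hj
    · rw [Function.update_self, Complex.add_im, Complex.neg_im]
      linarith
    · rw [Function.update_of_ne hj]
      exact hz j
  · rw [hma.aeval_update, ← hh, ← hf]
    field_simp
    ring

theorem RealStable.splits_diagPoly {n : ℕ} {g : MvPolynomial (Fin n) ℝ} (hg : RealStable g) :
    (diagPoly g).Splits := by
  refine Polynomial.Splits.of_splits_map (algebraMap ℝ ℂ) (IsAlgClosed.splits _) ?_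
  intro z hz
  have hz : Polynomial.aeval z (diagPoly g) = 0 := by
    rw [Polynomial.aeval_def, ← Polynomial.eval_map]
    exact Polynomial.isRoot_of_mem_roots hz
  have hnot : ∀ w : ℂ, 0 < w.im → Polynomial.aeval w (diagPoly g) ≠ 0 := by
    intro w hw
    rw [aeval_diagPoly]
    exact hg.aeval_ne_zero fun _ => hw
  have him : z.im = 0 := by
    rcases lt_trichotomy z.im 0 with h | h | h
    · refine absurd ?_ (hnot ((starRingEnd ℂ) z) (by simpa using h))
      rw [Polynomial.aeval_conj, hz, map_zero]
    · exact h
    · exact absurd hz (hnot z h)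
  exact ⟨z.re, by apply Complex.ext <;> simp [him]⟩

theorem barrier_pow {n : ℕ} (i : Fin n) (g : MvPolynomial (Fin n) ℝ) (u : Fin n → ℝ)
    (hu : MvPolynomial.eval u g ≠ 0) {r : ℕ} (hr : r ≠ 0) :
    barrier i (g ^ r) u = r * barrier i g u := by
  obtain ⟨k, rfl⟩ := Nat.exists_eq_succ_of_ne_zero hr
  rw [barrier, barrier, MvPolynomial.pderiv_pow, Nat.succ_eq_add_one, Nat.add_sub_cancel]
  simp only [map_mul, map_pow, map_natCast, pow_succ]
  field_simp

/-- If `Im (h / f) ≥ Im z` on the upper half plane and the roots of `h` lie in `[0, 1]`, then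
`f / h` is bounded to the right of `1` by convexity of `l ↦ 1 / (b - l)`. -/
theorem eval_div_le_of_im_le {f h : Polynomial ℝ} {m : ℕ} {α b : ℝ} (hm : h.Monic)
    (hN : h.natDegree = m + 1) (hs : h.Splits) (hroots : ∀ x, h.IsRoot x → x ∈ Set.Icc (0 : ℝ) 1)
    (hfd : f.natDegree ≤ m) (hfm : f.coeff m = 1)
    (hα : (Polynomial.X * f).coeff m - h.coeff m ≤ α)
    (hp : ∀ z : ℂ, 0 < z.im → z.im * Complex.normSq (Polynomial.aeval z f) ≤
      (Polynomial.aeval z h * (starRingEnd ℂ) (Polynomial.aeval z f)).im)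
    (hb : 1 < b) : f.eval b / h.eval b ≤ α / (b - 1) + (1 - α) / b := by
  have hd : f.degree < h.degree :=
    Polynomial.degree_lt_degree (by omega)
  obtain ⟨s, c, q, hq, hf⟩ := exists_partialFractions _ f h hN hm hs hd hp
  have hqm : ∀ l ∈ s, (q l).Monic ∧ (q l).natDegree = m := by
    intro l hl
    have h1 := (hq l hl).2.2
    have hqm : (q l).Monic := (Polynomial.monic_X_sub_C l).of_mul_monic_left (h1 ▸ hm)
    refine ⟨hqm, ?_⟩
    have h2 := congrArg Polynomial.natDegree h1
    rw [hN, (Polynomial.monic_X_sub_C l).natDegree_mul hqm, Polynomial.natDegree_X_sub_C] at h2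
    omega
  have hqc : ∀ l ∈ s, (q l).coeff m = 1 := by
    intro l hl
    rw [← (hqm l hl).2]
    exact (hqm l hl).1
  have hsum : ∑ l ∈ s, c l = 1 := by
    rw [hf, Polynomial.finsetSum_coeff] at hfm
    rw [← hfm]
    refine Finset.sum_congr rfl fun l hl => ?_
    rw [Polynomial.coeff_C_mul, hqc l hl, mul_one]
  have hmean : ∑ l ∈ s, c l * l = (Polynomial.X * f).coeff m - h.coeff m := by
    have h1 : (Polynomial.X * f).coeff m = ∑ l ∈ s, c l * (h.coeff m + l) := by
      rw [hf, Finset.mul_sum, Polynomial.finsetSum_coeff]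
      refine Finset.sum_congr rfl fun l hl => ?_
      have h2 : Polynomial.X * q l = h + Polynomial.C l * q l := by
        conv_rhs => rw [(hq l hl).2.2]
        ring
      rw [mul_left_comm, Polynomial.coeff_C_mul, h2, Polynomial.coeff_add, Polynomial.coeff_C_mul,
        hqc l hl, mul_one]
    rw [h1]
    simp only [mul_add, Finset.sum_add_distrib, ← Finset.sum_mul, hsum]
    ring
  have hb0 : 0 < b - 1 := by linarith
  have hb1 : 0 < b := by linarith
  have hhb : h.eval b ≠ 0 := fun h0 => by
    have := (hroots b h0).2
    linarith
  have hle : f.eval b / h.eval b ≤ ∑ l ∈ s, c l * (l / (b - 1) + (1 - l) / b) := by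
    conv_lhs => rw [hf]
    rw [Polynomial.eval_finsetSum, Finset.sum_div]
    refine Finset.sum_le_sum fun l hl => ?_
    obtain ⟨h1, h2, h3⟩ := hq l hl
    obtain ⟨hl0, hl1⟩ := hroots l h1
    have hbl : 0 < b - l := by linarith
    have h4 : h.eval b = (b - l) * (q l).eval b := by
      conv_lhs => rw [h3]
      simp
    have hqb : (q l).eval b ≠ 0 := right_ne_zero_of_mul (h4 ▸ hhb)
    rw [Polynomial.eval_mul, Polynomial.eval_C, mul_div_assoc]
    refine mul_le_mul_of_nonneg_left ?_ h2
    rw [h4, div_mul_cancel_right₀ hqb, inv_eq_one_div, div_add_div _ _ hb0.ne' hb1.ne',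
      div_le_div_iff₀ hbl (by positivity)]
    nlinarith [mul_nonneg hl0 (sub_nonneg.2 hl1)]
  refine hle.trans ?_
  have h5 : ∑ l ∈ s, c l * (l / (b - 1) + (1 - l) / b) =
      (∑ l ∈ s, c l * l) * (1 / (b - 1) - 1 / b) + (∑ l ∈ s, c l) * (1 / b) := by
    rw [Finset.sum_mul, Finset.sum_mul, ← Finset.sum_add_distrib]
    exact Finset.sum_congr rfl fun l _ => by ring
  rw [h5, hsum, hmean]
  have h6 : 0 ≤ 1 / (b - 1) - 1 / b :=
    sub_nonneg.2 (one_div_le_one_div_of_le hb0 (by linarith))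
  calc _ ≤ α * (1 / (b - 1) - 1 / b) + 1 * (1 / b) := by gcongr
    _ = _ := by ring

theorem stmt12 (r : ℕ) (hr : 2 ≤ r) (α : ℝ) (hα0 : 0 < α)
    (hα1 : α ≤ ((r : ℝ) - 1) ^ 2 / (r : ℝ) ^ 2)
    (n : ℕ) (g : MvPolynomial (Fin n) ℝ)
    (hstable : RealStable g) (hma : MultiAffine g)
    (hroots : ∀ x : ℝ, (diagPoly g).IsRoot x → x ∈ Set.Icc (0 : ℝ) 1)
    (ha0 : MvPolynomial.coeff (expOf (Finset.univ : Finset (Fin n))) g = 1)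
    (hai : ∀ i : Fin n, |MvPolynomial.coeff (expOf ({i} : Finset (Fin n))ᶜ) g| ≤ α)
    (b : ℝ) (hb : 1 < b) :
    ∀ i : Fin n, barrier i (g ^ r) (fun _ => b) ≤
      (r : ℝ) * (α / (b - 1) + (1 - α) / b) := by
  intro i
  obtain ⟨m, rfl⟩ : ∃ m, n = m + 1 := Nat.exists_eq_succ_of_ne_zero (Fin.pos i).ne'
  have hsupp : ∀ s ∈ g.support, s ≤ expOf (Finset.univ : Finset (Fin (m + 1))) := by
    intro s hs j
    simpa [expOf_apply] using hma.le_one (MvPolynomial.mem_support_iff.1 hs) j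
  have hcard : (Finset.univ : Finset (Fin (m + 1))).card = m + 1 := by simp
  have hcard' : (({i} : Finset (Fin (m + 1)))ᶜ).card = m := by
    simp [Finset.card_compl]
  have hdeg := natDegree_diagPoly_le hsupp
  have hcoeff := coeff_diagPoly_card hsupp
  rw [hcard] at hdeg hcoeff
  rw [ha0] at hcoeff
  set g₀ := g - MvPolynomial.X i * MvPolynomial.pderiv i g with hg₀
  have hsupp₀ : ∀ s ∈ g₀.support, s ≤ expOf ({i} : Finset (Fin (m + 1)))ᶜ := by
    intro s hs j
    have h1 := MvPolynomial.mem_support_iff.1 hs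
    rw [hg₀, hma.coeff_sub_X_mul_pderiv] at h1
    obtain ⟨h2, h3⟩ : s i = 0 ∧ MvPolynomial.coeff s g ≠ 0 := by simpa using h1
    rcases eq_or_ne j i with rfl | hj
    · simp [h2]
    · simpa [expOf_apply, hj] using hma.le_one h3 j
  have hdeg₀ := natDegree_diagPoly_le hsupp₀
  have hcoeff₀ := coeff_diagPoly_card hsupp₀
  rw [hcard'] at hdeg₀ hcoeff₀
  rw [hg₀, hma.coeff_sub_X_mul_pderiv, if_pos (by simp [expOf_apply]), ← hg₀] at hcoeff₀
  have hdecomp : diagPoly g₀ = diagPoly g -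
      Polynomial.X * diagPoly (MvPolynomial.pderiv i g) := by
    simp [hg₀, diagPoly]
  set h := diagPoly g with hh
  set f := diagPoly (MvPolynomial.pderiv i g) with hf
  have hXf : Polynomial.X * f = h - diagPoly g₀ := by rw [hdecomp]; ring
  have hN : h.natDegree = m + 1 :=
    Polynomial.natDegree_eq_of_le_of_coeff_ne_zero hdeg (by simp [hcoeff])
  have hmonic : h.Monic := Polynomial.monic_of_natDegree_le_of_coeff_eq_one _ hdeg hcoeff
  have hfm : f.coeff m = 1 := by
    rw [← Polynomial.coeff_X_mul, hXf, Polynomial.coeff_sub, hcoeff,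
      Polynomial.coeff_eq_zero_of_natDegree_lt (by omega : (diagPoly g₀).natDegree < m + 1),
      sub_zero]
  have hf0 : f ≠ 0 := fun h0 => by simp [h0] at hfm
  have hfd : f.natDegree ≤ m := by
    have h1 : (Polynomial.X * f).natDegree ≤ m + 1 := by
      rw [hXf]
      exact (Polynomial.natDegree_sub_le _ _).trans (max_le hdeg (by omega))
    rw [Polynomial.natDegree_X_mul hf0] at h1
    omega
  have hα : (Polynomial.X * f).coeff m - h.coeff m ≤ α := by
    rw [hXf, Polynomial.coeff_sub, hcoeff₀]
    have := (abs_le.1 (hai i)).1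
    linarith
  have hbound := eval_div_le_of_im_le hmonic hN hstable.splits_diagPoly hroots hfd hfm hα
    (fun z hz => by
      rw [hf, hh, aeval_diagPoly, aeval_diagPoly]
      exact hstable.im_mul_normSq_le hma i fun _ => hz) hb
  have heval : ∀ q : MvPolynomial (Fin (m + 1)) ℝ,
      (diagPoly q).eval b = MvPolynomial.eval (fun _ => b) q := by
    intro q
    rw [← Polynomial.coe_aeval_eq_eval, aeval_diagPoly]
    rfl
  have hgb : MvPolynomial.eval (fun _ => b) g ≠ 0 := by
    rw [← heval]
    intro h0
    have := (hroots b h0).2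
    linarith
  rw [barrier_pow i g _ hgb (by omega)]
  refine mul_le_mul_of_nonneg_left ?_ (Nat.cast_nonneg r)
  rwa [hf, hh, heval, heval] at hbound
end

section
/- Let 𝔛 be a strongly Rayleigh point process on [n] and let λ_1,…,λ_n be the roots of the diagonalization ḡ_𝔛 of its kernel polynomial (these lie in [0,1]). Then for every k ∈ {0,1,…,n}, ℙ(|𝔛| = k) = Σ_{A ⊆ [n], |A| = k} Π_{i∈A} λ_i · Π_{i∉A} (1 − λ_i); that is, |𝔛| has the same distribution as the sum of n independent Bernoulli random variables with success probabilities λ_1,…,λ_n. -/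
open MvPolynomial Polynomial

/-- `μ` is the law of a point process on `[n]`, i.e. a probability
distribution on subsets of `[n]`. -/
def IsPointProcess {n : ℕ} (μ : Finset (Fin n) → ℝ) : Prop :=
  (∀ A, 0 ≤ μ A) ∧ (∑ A : Finset (Fin n), μ A) = 1

/-- The probability generating polynomial `f_𝔛(z) = Σ_A ℙ(𝔛 = A) z^A`. -/
noncomputable def genPoly {n : ℕ} (μ : Finset (Fin n) → ℝ) : MvPolynomial (Fin n) ℝ :=
  ∑ A : Finset (Fin n), MvPolynomial.monomial (expOf A) (μ A)

/-- A point process is strongly Rayleigh if its probability generating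
polynomial is real stable. -/
def StronglyRayleigh {n : ℕ} (μ : Finset (Fin n) → ℝ) : Prop :=
  IsPointProcess μ ∧ RealStable (genPoly μ)

/-- `ℙ(A ⊆ 𝔛)`. -/
noncomputable def probSupset {n : ℕ} (μ : Finset (Fin n) → ℝ) (A : Finset (Fin n)) : ℝ :=
  ∑ B ∈ Finset.univ.filter (fun B : Finset (Fin n) => A ⊆ B), μ B

/-- The kernel polynomial `g_𝔛(z) = Σ_A (−1)^{|A|} ℙ(A ⊆ 𝔛) z^{A^c}`. -/
noncomputable def kernelPoly {n : ℕ} (μ : Finset (Fin n) → ℝ) : MvPolynomial (Fin n) ℝ :=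
  ∑ A : Finset (Fin n),
    MvPolynomial.monomial (expOf Aᶜ) ((-1 : ℝ) ^ A.card * probSupset μ A)

lemma eval_diagPoly_monomial_expOf {n : ℕ} (A : Finset (Fin n)) (c x : ℝ) :
    (diagPoly (MvPolynomial.monomial (expOf A) c)).eval x = c * x ^ A.card := by
  have h : MvPolynomial.monomial (expOf A) c
      = MvPolynomial.C c * ∏ i ∈ A, (MvPolynomial.X i : MvPolynomial (Fin n) ℝ) := by
    rw [expOf, MvPolynomial.monomial_eq]
    congr 1
    rw [← MvPolynomial.monic_monomial_eq, MvPolynomial.monomial_sum_one]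
    rfl
  simp [h, diagPoly]

lemma sum_subset_neg_one_pow_mul_pow {n : ℕ} (B : Finset (Fin n)) (x : ℝ) :
    ∑ A ∈ B.powerset, (-1 : ℝ) ^ A.card * x ^ (Aᶜ).card
      = (x - 1) ^ B.card * x ^ (Bᶜ).card := by
  have h : x - 1 = -1 + x := by ring
  rw [h, ← Finset.sum_pow_mul_eq_add_pow, Finset.sum_mul]
  refine Finset.sum_congr rfl fun A hA => ?_
  have h₁ := Finset.card_le_card (Finset.mem_powerset.mp hA)
  have h₂ := Finset.card_le_univ B
  rw [mul_assoc, ← pow_add]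
  congr 2
  simp only [Finset.card_compl]
  omega

/-- The diagonalized kernel polynomial, expanded in the basis `(x - 1)^k x^(n - k)`. -/
lemma eval_diagPoly_kernelPoly {n : ℕ} (μ : Finset (Fin n) → ℝ) (x : ℝ) :
    (diagPoly (kernelPoly μ)).eval x
      = ∑ B : Finset (Fin n), μ B * ((x - 1) ^ B.card * x ^ (Bᶜ).card) := by
  have h : (diagPoly (kernelPoly μ)).eval x
      = ∑ A : Finset (Fin n), (-1 : ℝ) ^ A.card * probSupset μ A * x ^ (Aᶜ).card := by
    simp_rw [← eval_diagPoly_monomial_expOf]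
    simp only [diagPoly, kernelPoly, map_sum, Polynomial.eval_finsetSum]
  rw [h]
  simp_rw [← sum_subset_neg_one_pow_mul_pow, probSupset, Finset.mul_sum, Finset.sum_mul]
  rw [Finset.sum_comm' (t' := Finset.univ) (s' := fun B => B.powerset) (by simp)]
  exact Finset.sum_congr rfl fun B _ => Finset.sum_congr rfl fun A _ => by ring

lemma prod_sub_eq_sum {n : ℕ} (lam : Fin n → ℝ) (x : ℝ) :
    ∏ i, (x - lam i) = ∑ B : Finset (Fin n),
      ((∏ i ∈ B, lam i) * ∏ i ∈ Bᶜ, (1 - lam i)) * ((x - 1) ^ B.card * x ^ (Bᶜ).card) := by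
  have h : ∀ i, x - lam i = lam i * (x - 1) + (1 - lam i) * x := fun i => by ring
  simp_rw [h]
  rw [Fintype.prod_add]
  refine Finset.sum_congr rfl fun B _ => ?_
  simp only [Finset.prod_mul_distrib, Finset.prod_const]
  ring

/-- The polynomials `(x - 1)^k x^(n - k)`, `0 ≤ k ≤ n`, are linearly independent. -/
lemma sum_card_eq_zero_of_forall {n : ℕ} (d : Finset (Fin n) → ℝ)
    (hd : ∀ x : ℝ, ∑ B, d B * ((x - 1) ^ B.card * x ^ (Bᶜ).card) = 0) (k : ℕ) :
    ∑ B with B.card = k, d B = 0 := by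
  set P : Polynomial ℝ := ∑ B, Polynomial.monomial B.card (d B) with hP
  have hroot : ∀ t : ℝ, t ≠ 1 → P.IsRoot t := by
    intro t ht
    have ht' : (1 - t) ≠ 0 := sub_ne_zero.mpr ht.symm
    have h : P.eval t = (1 - t) ^ n *
        ∑ B, d B * (((1 - t)⁻¹ - 1) ^ B.card * (1 - t)⁻¹ ^ (Bᶜ).card) := by
      rw [hP, Polynomial.eval_finsetSum, Finset.mul_sum]
      refine Finset.sum_congr rfl fun B _ => ?_
      have hn : B.card + (Bᶜ).card = n := by simp
      have hx : (1 - t)⁻¹ - 1 = t * (1 - t)⁻¹ := by field_simp; ring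
      have hc : (1 - t) ^ n * ((1 - t)⁻¹ ^ B.card * (1 - t)⁻¹ ^ (Bᶜ).card) = 1 := by
        rw [← pow_add, hn, ← mul_pow, mul_inv_cancel₀ ht', one_pow]
      rw [Polynomial.eval_monomial, hx, mul_pow]
      linear_combination -(d B * t ^ B.card) * hc
    rw [Polynomial.IsRoot, h, hd, mul_zero]
  have hP0 : P = 0 := Polynomial.eq_zero_of_infinite_isRoot P <|
    (Set.finite_singleton (1 : ℝ)).infinite_compl.mono fun t ht => hroot t ht
  have hk := congrArg (fun Q => Polynomial.coeff Q k) hP0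
  rw [Finset.sum_filter]
  simpa [hP, Polynomial.coeff_monomial] using hk

theorem stmt17 (n : ℕ) (μ : Finset (Fin n) → ℝ) (hμ : StronglyRayleigh μ)
    (lam : Fin n → ℝ)
    (hlam : diagPoly (kernelPoly μ) = ∏ i, (Polynomial.X - Polynomial.C (lam i))) :
    ∀ k : ℕ, k ≤ n →
      (∑ A ∈ Finset.univ.filter (fun A : Finset (Fin n) => A.card = k), μ A) =
        ∑ A ∈ Finset.univ.filter (fun A : Finset (Fin n) => A.card = k),
          (∏ i ∈ A, lam i) * ∏ i ∈ Aᶜ, (1 - lam i) := by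
  intro k _
  rw [← sub_eq_zero, ← Finset.sum_sub_distrib]
  refine sum_card_eq_zero_of_forall _ (fun x => ?_) k
  have hx := congrArg (Polynomial.eval x) hlam
  simp only [Polynomial.eval_prod, Polynomial.eval_sub, Polynomial.eval_X, Polynomial.eval_C,
    eval_diagPoly_kernelPoly, prod_sub_eq_sum] at hx
  simp only [sub_mul, Finset.sum_sub_distrib] at hx ⊢
  exact sub_eq_zero.mpr hx
end
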